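/- Let X be a topological space and let C ⊆ X. Then C ∈ CO_δ(X) if and only if there exists a continuous map f : X → ℕ(∞) such that C = f⁻¹({∞}), where ℕ(∞) denotes the one-point (Alexandroff) compactification of the discrete space ℕ and ∞ is its point at infinity. -/

import Mathlib

open Topology TopologicalSpace Set

/-- `A ∈ CO_δ(X)`: `A` is the intersection of a nonempty countable family of clopen
subsets of `X`. -/
def MemCOdelta {X : Type*} [TopologicalSpace X] (A : Set X) : Prop :=
  ∃ 𝒞 : Set (Set X), 𝒞.Countable ∧ 𝒞.Nonempty ∧ (∀ C ∈ 𝒞, IsClopen C) ∧ A = ⋂₀ 𝒞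

/-- For a topological space `X` and `C ⊆ X`, `C ∈ CO_δ(X)` if and only if there is
a continuous map `f` from `X` to the one-point (Alexandroff) compactification
`ℕ(∞)` of the discrete space `ℕ` with `C = f ⁻¹' {∞}`. -/
theorem stmt14 {X : Type*} [TopologicalSpace X] (C : Set X) :
    MemCOdelta C ↔
      ∃ f : X → OnePoint ℕ, Continuous f ∧ C = f ⁻¹' {OnePoint.infty} := by
  classical
  constructor
  · rintro ⟨F, hF, hne, hcl, rfl⟩
    obtain ⟨u, rfl⟩ := hF.exists_eq_range hne
    have hu : ∀ n, IsClopen (u n) := fun n => hcl _ ⟨n, rfl⟩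
    let f : X → OnePoint ℕ := fun x =>
      if h : ∃ n, x ∉ u n then ((Nat.find h : ℕ) : OnePoint ℕ) else OnePoint.infty
    have hfib : ∀ n : ℕ, f ⁻¹' {(n : OnePoint ℕ)} = (u n)ᶜ ∩ ⋂ i ∈ Finset.range n, u i := by
      intro n
      ext x
      by_cases h : ∃ n, x ∉ u n
      · simp [f, h, Nat.find_eq_iff]
      · have h' := h
        push Not at h'
        simp [f, h']
    have hfc : ∀ n : ℕ, IsClopen (f ⁻¹' {(n : OnePoint ℕ)}) := by
      intro n
      rw [hfib]
      exact (hu n).compl.inter (isClopen_biInter_finset fun i _ => hu i)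
    have key : ∀ t : Set (OnePoint ℕ), OnePoint.infty ∉ t →
        f ⁻¹' t = ⋃ n ∈ ((↑) ⁻¹' t : Set ℕ), f ⁻¹' {(n : OnePoint ℕ)} := by
      intro t ht
      ext x
      simp only [mem_preimage, mem_iUnion, mem_singleton_iff, exists_prop]
      constructor
      · intro hx
        have hne : f x ≠ OnePoint.infty := fun h => ht (h ▸ hx)
        obtain ⟨n, hn⟩ := OnePoint.ne_infty_iff_exists.1 hne
        exact ⟨n, by rwa [hn], hn.symm⟩
      · rintro ⟨n, hn, h⟩
        rwa [h]
    refine ⟨f, ⟨fun s hs => ?_⟩, ?_⟩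
    · by_cases h : OnePoint.infty ∈ s
      · have hc := ((OnePoint.isOpen_iff_of_mem' h).1 hs).1
        rw [← isClosed_compl_iff, ← preimage_compl, key _ (by simpa using h)]
        exact (isCompact_iff_finite.1 hc).isClosed_biUnion fun n _ => (hfc n).1
      · rw [key s h]
        exact isOpen_biUnion fun n _ => (hfc n).2
    · ext x
      by_cases h : ∃ n, x ∉ u n
      · simpa [f, h] using h
      · have h' := h
        push Not at h'
        simp [f, h']
  · rintro ⟨f, hf, rfl⟩
    refine ⟨range fun n : ℕ => (f ⁻¹' {(n : OnePoint ℕ)})ᶜ, countable_range _,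
      range_nonempty _, ?_, ?_⟩
    · rintro _ ⟨n, rfl⟩
      refine (IsClopen.preimage ⟨isClosed_singleton, ?_⟩ hf).compl
      have := OnePoint.isOpen_image_coe.2 (isOpen_discrete ({n} : Set ℕ))
      simpa using this
    · ext x
      simp only [sInter_range, mem_iInter, mem_compl_iff, mem_preimage, mem_singleton_iff]
      constructor
      · intro h n
        simp [h]
      · intro h
        by_contra hne
        obtain ⟨n, hn⟩ := OnePoint.ne_infty_iff_exists.1 hne
        exact h n hn.symm
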